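/- Let d ≥ 2 and let Γ be a countable subgroup of SL(d,ℝ) which is Zariski dense, in the sense that every real polynomial in the d² matrix entries which vanishes at every element of Γ also vanishes at every element of SL(d,ℝ). Let μ be a probability measure on Γ whose support generates Γ as a semigroup, with finite entropy H(μ) < ∞ and finite first moment ∑_{g∈Γ} μ({g}) log‖g‖ < ∞. Let γ ∈ Γ be ℝ-regular, i.e. γ = h⁻¹δh for some invertible real d×d matrix h and some diagonal matrix δ = diag(δ₁,…,δ_d) whose diagonal entries have pairwise distinct absolute values. For k ∈ ℕ set μ^k = (1/2)μ + (1/4)(δ_{γ^k} + δ_{γ^{−k}}), where δ_g is the Dirac measure at g, and define the top Lyapunov exponent λ₁(μ^k) = liminf_{n→∞} (1/n) ∑_{g∈Γ} (μ^k)^{∗n}({g}) log‖g‖. Then λ₁(μ^k) → +∞ as k → ∞. -/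

import Mathlib

open Filter
open scoped Matrix Topology

/-- The Euclidean norm on `ℝ^d`. -/
noncomputable def eNorm {d : ℕ} (v : Fin d → ℝ) : ℝ :=
  ‖(WithLp.equiv 2 (Fin d → ℝ)).symm v‖

/-- The operator norm of a real `d × d` matrix acting on Euclidean `ℝ^d`. -/
noncomputable def opNorm {d : ℕ} (h : Matrix (Fin d) (Fin d) ℝ) : ℝ :=
  ⨆ v : {v : Fin d → ℝ // eNorm v ≤ 1}, eNorm (h.mulVec v.1)

/-- Convolution of two distributions on a countable group:
`(μ ∗ η)(g) = ∑_h μ(g h⁻¹) η(h)`. -/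
noncomputable def conv {G : Type*} [Group G] (μ η : G → ℝ) : G → ℝ :=
  fun g => ∑' h : G, μ (g * h⁻¹) * η h

/-- `n`-fold convolution power of a distribution on a countable group (`μ^{∗0}` is the Dirac
mass at the identity, `μ^{∗(n+1)} = μ^{∗n} ∗ μ`). -/
noncomputable def convPow {G : Type*} [Group G] [DecidableEq G] (μ : G → ℝ) : ℕ → G → ℝ
  | 0 => fun g => if g = 1 then 1 else 0
  | n + 1 => conv (convPow μ n) μ

/-- The entropy `H(μ) = -∑_g μ(g) log μ(g)` of a probability distribution on a countable
group, with the convention `0 · log 0 = 0`. -/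
noncomputable def entropy {G : Type*} (μ : G → ℝ) : ℝ :=
  ∑' g : G, Real.negMulLog (μ g)


section Abstract

variable {G : Type*} [Group G]

/-- the substitution `(g, h) ↦ (g * h, h)` -/
def mulShear (G : Type*) [Group G] : G × G ≃ G × G where
  toFun q := (q.1 * q.2, q.2)
  invFun q := (q.1 * q.2⁻¹, q.2)
  left_inv q := by simp
  right_inv q := by simp

lemma conv_aux (μ η F : G → ℝ)
    (hs : Summable fun q : G × G => μ q.1 * η q.2 * F (q.1 * q.2)) :
    Summable (fun g => conv μ η g * F g) ∧
      ∑' g, conv μ η g * F g = ∑' h, η h * ∑' g, μ g * F (g * h) := by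
  have h1 : Summable fun q : G × G => μ (q.1 * q.2⁻¹) * η q.2 * F q.1 := by
    rw [← (mulShear G).summable_iff]
    refine hs.congr fun q => ?_
    simp [mulShear]
  have e1 : (fun g => conv μ η g * F g) = fun g => ∑' h, μ (g * h⁻¹) * η h * F g := by
    funext g
    rw [conv, tsum_mul_right]
  refine ⟨?_, ?_⟩
  · rw [e1]
    exact h1.prod
  · rw [e1, ← h1.tsum_prod, ← (mulShear G).tsum_eq]
    have : (fun q : G × G => μ ((mulShear G q).1 * (mulShear G q).2⁻¹) * η (mulShear G q).2 *
        F (mulShear G q).1) = fun q : G × G => μ q.1 * η q.2 * F (q.1 * q.2) := by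
      funext q
      simp [mulShear]
    rw [this]
    have hs' : Summable fun q : G × G => μ q.2 * η q.1 * F (q.2 * q.1) := by
      have := (Equiv.prodComm G G).summable_iff.mpr hs
      exact this
    rw [← (Equiv.prodComm G G).tsum_eq]
    simp only [Equiv.prodComm_apply, Prod.fst_swap, Prod.snd_swap]
    rw [hs'.tsum_prod]
    congr 1; funext h
    rw [← tsum_mul_left]
    congr 1; funext g
    ring

variable [DecidableEq G]

/-- package of facts on the convolution powers -/
lemma convPow_facts (ν ℓ : G → ℝ) (h0 : ∀ g, 0 ≤ ν g) (h1 : HasSum ν 1)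
    (hℓ0 : ∀ g, 0 ≤ ℓ g) (hℓ : ∀ g h, ℓ (g * h) ≤ ℓ g + ℓ h)
    (hs : Summable fun g => ν g * ℓ g) (n : ℕ) :
    (∀ g, 0 ≤ convPow ν n g) ∧ HasSum (convPow ν n) 1 ∧
      Summable (fun g => convPow ν n g * ℓ g) ∧
      ∑' g, convPow ν n g * ℓ g ≤ ℓ 1 + n * ∑' g, ν g * ℓ g := by
  induction n with
  | zero =>
    have e : (fun g => convPow ν 0 g * ℓ g) = fun g => if g = 1 then ℓ 1 else 0 := by
      funext g
      by_cases hg : g = 1 <;> simp [convPow, hg]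
    refine ⟨fun g => ?_, ?_, ?_, ?_⟩
    · simp only [convPow]; split_ifs <;> norm_num
    · exact hasSum_ite_eq (1 : G) (1 : ℝ)
    · rw [e]; exact (hasSum_ite_eq (1 : G) (ℓ 1)).summable
    · rw [e, (hasSum_ite_eq (1 : G) (ℓ 1)).tsum_eq]; simp
  | succ n ih =>
    obtain ⟨p0, p1, p2, p3⟩ := ih
    set P := convPow ν n with hP
    have hPν : Summable fun q : G × G => P q.1 * ν q.2 :=
      p1.summable.mul_of_nonneg h1.summable p0 h0
    have sℓ1 : Summable fun q : G × G => (P q.1 * ℓ q.1) * ν q.2 :=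
      p2.mul_of_nonneg h1.summable (fun g => mul_nonneg (p0 g) (hℓ0 g)) h0
    have sℓ2 : Summable fun q : G × G => P q.1 * (ν q.2 * ℓ q.2) :=
      p1.summable.mul_of_nonneg hs p0 (fun g => mul_nonneg (h0 g) (hℓ0 g))
    have sℓ : Summable fun q : G × G => P q.1 * ν q.2 * ℓ (q.1 * q.2) := by
      refine Summable.of_nonneg_of_le (fun q => ?_) (fun q => ?_) (sℓ1.add sℓ2)
      · exact mul_nonneg (mul_nonneg (p0 _) (h0 _)) (hℓ0 _)
      · have := mul_le_mul_of_nonneg_left (hℓ q.1 q.2) (mul_nonneg (p0 q.1) (h0 q.2))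
        linarith
    have A := conv_aux P ν (fun _ => 1) (by simpa using hPν)
    have B := conv_aux P ν ℓ sℓ
    refine ⟨fun g => ?_, ?_, B.1, ?_⟩
    · exact tsum_nonneg fun h => mul_nonneg (p0 _) (h0 _)
    · have hsum : Summable (conv P ν) := by simpa using A.1
      have : ∑' g, conv P ν g = 1 := by
        have := A.2
        simp only [mul_one, p1.tsum_eq, h1.tsum_eq] at this
        exact this
      rw [← this]
      exact hsum.hasSum
    · change ∑' g, conv P ν g * ℓ g ≤ _
      rw [B.2]
      have key : ∀ h, ν h * ∑' g, P g * ℓ (g * h) ≤ ν h * (∑' g, P g * ℓ g) + ν h * ℓ h := by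
        intro h
        rw [← mul_add]
        refine mul_le_mul_of_nonneg_left ?_ (h0 h)
        have s2 : Summable fun g => P g * ℓ h := p1.summable.mul_right _
        have e2 : ∑' g, P g * ℓ h = ℓ h := by rw [tsum_mul_right, p1.tsum_eq, one_mul]
        calc ∑' g, P g * ℓ (g * h) ≤ ∑' g, (P g * ℓ g + P g * ℓ h) := by
              refine Summable.tsum_le_tsum (fun g => ?_) ?_ (p2.add s2)
              · rw [← mul_add]
                exact mul_le_mul_of_nonneg_left (hℓ g h) (p0 g)
              · refine Summable.of_nonneg_of_le (fun g => mul_nonneg (p0 g) (hℓ0 _)) (fun g => ?_)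
                  (p2.add s2)
                rw [← mul_add]
                exact mul_le_mul_of_nonneg_left (hℓ g h) (p0 g)
          _ = _ := by rw [p2.tsum_add s2, e2]
      have s3 : Summable fun h => ν h * (∑' g, P g * ℓ g) := h1.summable.mul_right _
      have s4 := s3.add hs
      have s5 : Summable fun h => ν h * ∑' g, P g * ℓ (g * h) :=
        Summable.of_nonneg_of_le (fun h => mul_nonneg (h0 h)
          (tsum_nonneg fun g => mul_nonneg (p0 g) (hℓ0 _))) key s4
      calc _ ≤ ∑' h, (ν h * (∑' g, P g * ℓ g) + ν h * ℓ h) := s5.tsum_le_tsum key s4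
        _ = (∑' g, P g * ℓ g) + ∑' h, ν h * ℓ h := by
          rw [s3.tsum_add hs, tsum_mul_right, h1.tsum_eq, one_mul]
        _ ≤ _ := by push_cast; linarith

/-- a function dominated by `K + ℓ` is summable against a probability with finite `ℓ`-moment -/
lemma summable_dom {G : Type*} (P ℓ F : G → ℝ) (K : ℝ) (p0 : ∀ g, 0 ≤ P g) (p1 : HasSum P 1)
    (p2 : Summable fun g => P g * ℓ g) (hF : ∀ g, |F g| ≤ K + ℓ g) :
    Summable (fun g => P g * F g) ∧ |∑' g, P g * F g| ≤ K + ∑' g, P g * ℓ g := by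
  have s1 : Summable fun g => P g * K + P g * ℓ g := (p1.summable.mul_right K).add p2
  have b : ∀ g, ‖P g * F g‖ ≤ P g * K + P g * ℓ g := fun g => by
    rw [Real.norm_eq_abs, abs_mul, abs_of_nonneg (p0 g), ← mul_add]
    exact mul_le_mul_of_nonneg_left (hF g) (p0 g)
  refine ⟨Summable.of_norm_bounded s1 b, ?_⟩
  have h2 := tsum_of_norm_bounded s1.hasSum b
  rw [Real.norm_eq_abs, (p1.summable.mul_right K).tsum_add p2, tsum_mul_right, p1.tsum_eq,
    one_mul] at h2
  exact h2

section Walk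

variable {X : Type*} [MulAction G X]

/-- mean of the cocycle after `n` steps -/
noncomputable def meanCoc (ν : G → ℝ) (σ : G → X → ℝ) (n : ℕ) (x : X) : ℝ :=
  ∑' g, convPow ν n g * σ g x

lemma meanCoc_succ (ν ℓ : G → ℝ) (h0 : ∀ g, 0 ≤ ν g) (h1 : HasSum ν 1)
    (hℓ0 : ∀ g, 0 ≤ ℓ g) (hℓ : ∀ g h, ℓ (g * h) ≤ ℓ g + ℓ h)
    (hs : Summable fun g => ν g * ℓ g)
    (σ : G → X → ℝ) (hσ : ∀ g h x, σ (g * h) x = σ g (h • x) + σ h x)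
    (K : ℝ) (hK : ∀ g x, |σ g x| ≤ K + ℓ g)
    (n : ℕ) (x : X) :
    Summable (fun h => ν h * meanCoc ν σ n (h • x)) ∧
    meanCoc ν σ (n + 1) x = ∑' g, ν g * σ g x + ∑' h, ν h * meanCoc ν σ n (h • x) := by
  obtain ⟨p0, p1, p2, -⟩ := convPow_facts ν ℓ h0 h1 hℓ0 hℓ hs n
  have sM : Summable (fun h => ν h * meanCoc ν σ n (h • x)) := by
    refine Summable.of_norm_bounded
      (h1.summable.mul_right (K + ∑' g, convPow ν n g * ℓ g)) fun h => ?_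
    rw [Real.norm_eq_abs, abs_mul, abs_of_nonneg (h0 h)]
    exact mul_le_mul_of_nonneg_left
      (summable_dom _ ℓ (fun g => σ g (h • x)) K p0 p1 p2 fun g => hK g _).2 (h0 h)
  refine ⟨sM, ?_⟩
  have hK' : ∀ g h : G, |σ (g * h) x| ≤ (K + ℓ g) + (K + ℓ h) := fun g h => by
    rw [hσ]
    exact (abs_add_le _ _).trans (add_le_add (hK _ _) (hK _ _))
  have q1 : Summable fun q : G × G => convPow ν n q.1 * ν q.2 :=
    p1.summable.mul_of_nonneg h1.summable p0 h0
  have q2 : Summable fun q : G × G => (convPow ν n q.1 * ℓ q.1) * ν q.2 :=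
    p2.mul_of_nonneg h1.summable (fun g => mul_nonneg (p0 g) (hℓ0 g)) h0
  have q3 : Summable fun q : G × G => convPow ν n q.1 * (ν q.2 * ℓ q.2) :=
    p1.summable.mul_of_nonneg hs p0 (fun g => mul_nonneg (h0 g) (hℓ0 g))
  have hsum : Summable fun q : G × G => convPow ν n q.1 * ν q.2 * σ (q.1 * q.2) x := by
    refine Summable.of_norm_bounded (((q1.mul_right (2 * K)).add q2).add q3) fun q => ?_
    have nn := mul_nonneg (p0 q.1) (h0 q.2)
    rw [Real.norm_eq_abs, abs_mul, abs_of_nonneg nn]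
    have := mul_le_mul_of_nonneg_left (hK' q.1 q.2) nn
    linarith
  have E := (conv_aux (convPow ν n) ν (fun g => σ g x) hsum).2
  have s1 := (summable_dom ν ℓ (fun g => σ g x) K h0 h1 hs fun g => hK g x).1
  change ∑' g, conv (convPow ν n) ν g * σ g x = _
  rw [E, ← s1.tsum_add sM]
  congr 1; funext h
  rw [← mul_add]
  congr 1
  have s2 := (summable_dom _ ℓ (fun g => σ g (h • x)) K p0 p1 p2 fun g => hK g _).1
  have s3 : Summable fun g => convPow ν n g * σ h x := p1.summable.mul_right _
  calc ∑' g, convPow ν n g * σ (g * h) x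
      = ∑' g, (convPow ν n g * σ g (h • x) + convPow ν n g * σ h x) := by
        congr 1; funext g; rw [hσ]; ring
    _ = _ := by
        rw [s2.tsum_add s3, tsum_mul_right, p1.tsum_eq, one_mul, add_comm]; rfl

lemma meanCoc_step (ν ℓ : G → ℝ) (h0 : ∀ g, 0 ≤ ν g) (h1 : HasSum ν 1)
    (hℓ0 : ∀ g, 0 ≤ ℓ g) (hℓ : ∀ g h, ℓ (g * h) ≤ ℓ g + ℓ h)
    (hs : Summable fun g => ν g * ℓ g)
    (σ : G → X → ℝ) (hσ : ∀ g h x, σ (g * h) x = σ g (h • x) + σ h x)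
    (K : ℝ) (hK : ∀ g x, |σ g x| ≤ K + ℓ g)
    (C : ℝ) (hD : ∀ x, -C ≤ ∑' g, ν g * σ g x)
    (n : ℕ) (s : ℝ) (hn : ∀ x, s ≤ meanCoc ν σ n x) (x : X) :
    s - C ≤ meanCoc ν σ (n + 1) x := by
  obtain ⟨a, b⟩ := meanCoc_succ ν ℓ h0 h1 hℓ0 hℓ hs σ hσ K hK n x
  have : s ≤ ∑' h, ν h * meanCoc ν σ n (h • x) := by
    have e : ∑' h, ν h * s = s := by rw [tsum_mul_right, h1.tsum_eq, one_mul]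
    rw [← e]
    exact (h1.summable.mul_right s).tsum_le_tsum
      (fun h => mul_le_mul_of_nonneg_left (hn _) (h0 h)) a
  linarith [hD x]

lemma meanCoc_steps (ν ℓ : G → ℝ) (h0 : ∀ g, 0 ≤ ν g) (h1 : HasSum ν 1)
    (hℓ0 : ∀ g, 0 ≤ ℓ g) (hℓ : ∀ g h, ℓ (g * h) ≤ ℓ g + ℓ h)
    (hs : Summable fun g => ν g * ℓ g)
    (σ : G → X → ℝ) (hσ : ∀ g h x, σ (g * h) x = σ g (h • x) + σ h x)
    (K : ℝ) (hK : ∀ g x, |σ g x| ≤ K + ℓ g)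
    (C : ℝ) (hD : ∀ x, -C ≤ ∑' g, ν g * σ g x)
    (n : ℕ) (s : ℝ) (hn : ∀ x, s ≤ meanCoc ν σ n x) (r : ℕ) (x : X) :
    s - C * r ≤ meanCoc ν σ (n + r) x := by
  induction r generalizing x with
  | zero => simpa using hn x
  | succ r ih =>
    have := meanCoc_step ν ℓ h0 h1 hℓ0 hℓ hs σ hσ K hK C hD (n + r) _ ih x
    push_cast
    rw [← add_assoc]
    linarith

lemma meanCoc_path (ν ℓ : G → ℝ) (h0 : ∀ g, 0 ≤ ν g) (h1 : HasSum ν 1)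
    (hℓ0 : ∀ g, 0 ≤ ℓ g) (hℓ : ∀ g h, ℓ (g * h) ≤ ℓ g + ℓ h)
    (hs : Summable fun g => ν g * ℓ g)
    (σ : G → X → ℝ) (hσ : ∀ g h x, σ (g * h) x = σ g (h • x) + σ h x)
    (K : ℝ) (hK : ∀ g x, |σ g x| ≤ K + ℓ g)
    (C L : ℝ) (hD : ∀ x, -C ≤ ∑' g, ν g * σ g x)
    (hL : 0 ≤ L) (good : X → Prop)
    (hgood : ∀ x, good x → -C + L ≤ ∑' g, ν g * σ g x)
    (w : G → ℝ) (hw0 : ∀ g, 0 ≤ w g) (hw : ∀ g, w g ≤ ν g)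
    (n : ℕ) (s : ℝ) (hn : ∀ x, s ≤ meanCoc ν σ n x) (l : List G) (x : X)
    (hl : good (l.prod • x)) :
    s - C * (l.length + 1) + (l.map w).prod * L ≤ meanCoc ν σ (n + l.length + 1) x := by
  induction l using List.reverseRecOn generalizing x with
  | nil =>
    obtain ⟨a, b⟩ := meanCoc_succ ν ℓ h0 h1 hℓ0 hℓ hs σ hσ K hK n x
    have : s ≤ ∑' h, ν h * meanCoc ν σ n (h • x) := by
      have e : ∑' h, ν h * s = s := by rw [tsum_mul_right, h1.tsum_eq, one_mul]
      rw [← e]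
      exact (h1.summable.mul_right s).tsum_le_tsum
        (fun h => mul_le_mul_of_nonneg_left (hn _) (h0 h)) a
    simp only [List.prod_nil, one_smul] at hl
    have := hgood x hl
    simp only [List.length_nil, List.map_nil, List.prod_nil, add_zero, Nat.cast_zero]
    linarith
  | append_singleton l y ih =>
    have hl' : good (l.prod • (y • x)) := by
      rw [smul_smul]; simpa using hl
    have A := ih (y • x) hl'
    obtain ⟨a, b⟩ := meanCoc_succ ν ℓ h0 h1 hℓ0 hℓ hs σ hσ K hK (n + l.length + 1) x
    have B := meanCoc_steps ν ℓ h0 h1 hℓ0 hℓ hs σ hσ K hK C hD n s hn (l.length + 1)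
    set t : ℝ := s - C * (l.length + 1) with ht
    set q : ℝ := (l.map w).prod * L with hq
    have hq0 : 0 ≤ q := mul_nonneg (List.prod_nonneg (by
      intro z hz
      obtain ⟨u, -, rfl⟩ := List.mem_map.1 hz
      exact hw0 u)) hL
    have S1 : HasSum (fun h => ν h * t + if h = y then ν y * q else 0) (1 * t + ν y * q) :=
      (h1.mul_right t).add (hasSum_ite_eq y (ν y * q))
    have key : 1 * t + ν y * q ≤ ∑' h, ν h * meanCoc ν σ (n + l.length + 1) (h • x) := by
      rw [← S1.tsum_eq]
      refine S1.summable.tsum_le_tsum (fun h => ?_) a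
      by_cases hh : h = y
      · subst hh
        simp only [if_true]
        rw [← mul_add]
        exact mul_le_mul_of_nonneg_left A (h0 h)
      · simp only [hh, if_false, add_zero]
        refine mul_le_mul_of_nonneg_left ?_ (h0 h)
        have := B (h • x)
        push_cast at this
        exact this
    have h3 : w y * q ≤ ν y * q := mul_le_mul_of_nonneg_right (hw y) hq0
    have e1 : n + (l ++ [y]).length + 1 = (n + l.length + 1) + 1 := by simp; ring
    rw [e1, b]
    simp only [List.length_append, List.length_singleton, List.map_append, List.map_cons,
      List.map_nil, List.prod_append, List.prod_singleton]
    push_cast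
    have h4 := hD x
    have : (l.map w).prod * w y * L = w y * q := by rw [hq]; ring
    rw [this]
    rw [ht] at key
    linarith

lemma meanCoc_block (ν ℓ : G → ℝ) (h0 : ∀ g, 0 ≤ ν g) (h1 : HasSum ν 1)
    (hℓ0 : ∀ g, 0 ≤ ℓ g) (hℓ : ∀ g h, ℓ (g * h) ≤ ℓ g + ℓ h)
    (hs : Summable fun g => ν g * ℓ g)
    (σ : G → X → ℝ) (hσ : ∀ g h x, σ (g * h) x = σ g (h • x) + σ h x)
    (K : ℝ) (hK : ∀ g x, |σ g x| ≤ K + ℓ g)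
    (C L : ℝ) (hD : ∀ x, -C ≤ ∑' g, ν g * σ g x)
    (hL : 0 ≤ L) (good : X → Prop)
    (hgood : ∀ x, good x → -C + L ≤ ∑' g, ν g * σ g x)
    (w : G → ℝ) (hw0 : ∀ g, 0 ≤ w g) (hw : ∀ g, w g ≤ ν g)
    (m : ℕ) (p : ℝ)
    (hpath : ∀ x, ∃ l : List G, l.length ≤ m ∧ p ≤ (l.map w).prod ∧ good (l.prod • x))
    (n : ℕ) (s : ℝ) (hn : ∀ x, s ≤ meanCoc ν σ n x) (x : X) :
    s + (p * L - C * (m + 1)) ≤ meanCoc ν σ (n + (m + 1)) x := by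
  -- pad at the end of the time (the beginning of the word)
  obtain ⟨l, l1, l2, l3⟩ := hpath x
  have B := meanCoc_steps ν ℓ h0 h1 hℓ0 hℓ hs σ hσ K hK C hD n s hn (m - l.length)
  have A := meanCoc_path ν ℓ h0 h1 hℓ0 hℓ hs σ hσ K hK C L hD hL good hgood w hw0 hw
    (n + (m - l.length)) _ B l x l3
  have e : n + (m - l.length) + l.length + 1 = n + (m + 1) := by omega
  rw [e] at A
  have e2 : ((m - l.length : ℕ) : ℝ) = m - l.length := by push_cast [l1]; rfl
  rw [e2] at A
  have := mul_le_mul_of_nonneg_right l2 hL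
  linarith

lemma meanCoc_linear (ν ℓ : G → ℝ) (h0 : ∀ g, 0 ≤ ν g) (h1 : HasSum ν 1)
    (hℓ0 : ∀ g, 0 ≤ ℓ g) (hℓ : ∀ g h, ℓ (g * h) ≤ ℓ g + ℓ h)
    (hs : Summable fun g => ν g * ℓ g)
    (σ : G → X → ℝ) (hσ : ∀ g h x, σ (g * h) x = σ g (h • x) + σ h x)
    (K : ℝ) (hK : ∀ g x, |σ g x| ≤ K + ℓ g)
    (C L : ℝ) (hD : ∀ x, -C ≤ ∑' g, ν g * σ g x)
    (hL : 0 ≤ L) (good : X → Prop)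
    (hgood : ∀ x, good x → -C + L ≤ ∑' g, ν g * σ g x)
    (w : G → ℝ) (hw0 : ∀ g, 0 ≤ w g) (hw : ∀ g, w g ≤ ν g)
    (m : ℕ) (p : ℝ)
    (hpath : ∀ x, ∃ l : List G, l.length ≤ m ∧ p ≤ (l.map w).prod ∧ good (l.prod • x))
    (hC : 0 ≤ C) (n : ℕ) (x : X) :
    (n / (m + 1 : ℝ)) * (p * L - C * (m + 1)) - (|p * L - C * (m + 1)| + C * (m + 1)) ≤
      meanCoc ν σ n x := by
  set c := p * L - C * (m + 1) with hc
  have z : ∀ x, 0 ≤ meanCoc ν σ 0 x := by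
    intro x
    have e0 : σ 1 x = 0 := by
      have := hσ 1 1 x
      simp only [mul_one, one_smul] at this
      linarith
    have e : (fun g => convPow ν 0 g * σ g x) = fun g => 0 := by
      funext g
      by_cases hg : g = 1 <;> simp [convPow, hg, e0]
    simp [meanCoc, e]
  have bl : ∀ (r q : ℕ) (x : X), q * c - C * r ≤ meanCoc ν σ (r + q * (m + 1)) x := by
    intro r q
    induction q with
    | zero =>
      intro x
      have := meanCoc_steps ν ℓ h0 h1 hℓ0 hℓ hs σ hσ K hK C hD 0 0 z r x
      simpa using this
    | succ q ih =>
      intro x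
      have := meanCoc_block ν ℓ h0 h1 hℓ0 hℓ hs σ hσ K hK C L hD hL good hgood w hw0 hw m p hpath
        (r + q * (m + 1)) _ ih x
      have e : r + (q + 1) * (m + 1) = r + q * (m + 1) + (m + 1) := by ring
      rw [e]
      push_cast
      linarith
  have hdm := Nat.mod_add_div n (m + 1)
  have hmod := Nat.mod_lt n (Nat.succ_pos m)
  have := bl (n % (m + 1)) (n / (m + 1)) x
  rw [mul_comm (n / (m + 1)) (m + 1), hdm] at this
  set r := n % (m + 1)
  set q := n / (m + 1)
  have hm : (0 : ℝ) < m + 1 := by positivity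
  have hr : (r : ℝ) ≤ m + 1 := by exact_mod_cast hmod.le
  have hn : (n : ℝ) = r + (m + 1) * q := by exact_mod_cast hdm.symm
  have e3 : (n : ℝ) / (m + 1) = r / (m + 1) + q := by rw [hn]; field_simp
  have e4 : (r : ℝ) / (m + 1) * c ≤ |c| := by
    calc (r : ℝ) / (m + 1) * c ≤ (r : ℝ) / (m + 1) * |c| :=
          mul_le_mul_of_nonneg_left (le_abs_self c) (by positivity)
      _ ≤ 1 * |c| := mul_le_mul_of_nonneg_right ((div_le_one hm).2 hr) (abs_nonneg c)
      _ = |c| := one_mul _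
  have e5 : C * r ≤ C * (m + 1) := mul_le_mul_of_nonneg_left hr hC
  rw [e3, add_mul]
  linarith

end Walk

end Abstract

section Geometry

variable {d : ℕ}

lemma eNorm_mulVec_le_clm (A : Matrix (Fin d) (Fin d) ℝ) (v : Fin d → ℝ) :
    eNorm (A.mulVec v) ≤ ‖Matrix.toEuclideanCLM (n := Fin d) (𝕜 := ℝ) A‖ * eNorm v :=
  (Matrix.toEuclideanCLM (n := Fin d) (𝕜 := ℝ) A).le_opNorm (WithLp.toLp 2 v)

lemma eNorm_nonneg' (v : Fin d → ℝ) : 0 ≤ eNorm v := norm_nonneg _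

lemma eNorm_smul' (c : ℝ) (v : Fin d → ℝ) : eNorm (c • v) = |c| * eNorm v := by
  have : (WithLp.equiv 2 (Fin d → ℝ)).symm (c • v) =
    c • (WithLp.equiv 2 (Fin d → ℝ)).symm v := rfl
  rw [eNorm, this, norm_smul]; rfl

lemma eNorm_eq_zero' (v : Fin d → ℝ) : eNorm v = 0 ↔ v = 0 := by
  have : (WithLp.equiv 2 (Fin d → ℝ)).symm v = WithLp.toLp 2 v := rfl
  rw [eNorm, this, norm_eq_zero, WithLp.toLp_eq_zero]

lemma opNorm_bdd (A : Matrix (Fin d) (Fin d) ℝ) :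
    BddAbove (Set.range fun v : {v : Fin d → ℝ // eNorm v ≤ 1} => eNorm (A.mulVec v.1)) := by
  refine ⟨‖Matrix.toEuclideanCLM (n := Fin d) (𝕜 := ℝ) A‖, ?_⟩
  rintro _ ⟨v, rfl⟩
  exact (eNorm_mulVec_le_clm A v.1).trans (mul_le_of_le_one_right (norm_nonneg _) v.2)

lemma eNorm_mulVec_le (A : Matrix (Fin d) (Fin d) ℝ) (v : Fin d → ℝ) :
    eNorm (A.mulVec v) ≤ opNorm A * eNorm v := by
  by_cases hv : eNorm v = 0
  · have := (eNorm_eq_zero' v).1 hv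
    subst this
    rw [Matrix.mulVec_zero, hv, mul_zero]
  · have hpos : 0 < eNorm v := lt_of_le_of_ne (eNorm_nonneg' v) (Ne.symm hv)
    have h1 : eNorm ((eNorm v)⁻¹ • v) ≤ 1 := by
      rw [eNorm_smul', abs_of_pos (inv_pos.2 hpos), inv_mul_cancel₀ hv]
    have h2 := le_ciSup (opNorm_bdd A) ⟨_, h1⟩
    simp only [Matrix.mulVec_smul, eNorm_smul', abs_of_pos (inv_pos.2 hpos)] at h2
    change _ ≤ opNorm A at h2
    rwa [inv_mul_le_iff₀ hpos, mul_comm] at h2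

lemma opNorm_le (A : Matrix (Fin d) (Fin d) ℝ) (c : ℝ) (hc : 0 ≤ c)
    (h : ∀ v, eNorm (A.mulVec v) ≤ c * eNorm v) : opNorm A ≤ c := by
  have : Nonempty {v : Fin d → ℝ // eNorm v ≤ 1} :=
    ⟨⟨0, by rw [(eNorm_eq_zero' _).2 rfl]; norm_num⟩⟩
  exact ciSup_le fun v => (h v.1).trans (mul_le_of_le_one_right hc v.2)

lemma opNorm_nonneg' (A : Matrix (Fin d) (Fin d) ℝ) : 0 ≤ opNorm A :=
  Real.iSup_nonneg fun _ => eNorm_nonneg' _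

lemma opNorm_mul_le (A B : Matrix (Fin d) (Fin d) ℝ) : opNorm (A * B) ≤ opNorm A * opNorm B := by
  refine opNorm_le _ _ (mul_nonneg (opNorm_nonneg' A) (opNorm_nonneg' B)) fun v => ?_
  rw [← Matrix.mulVec_mulVec, mul_assoc]
  exact (eNorm_mulVec_le A _).trans
    (mul_le_mul_of_nonneg_left (eNorm_mulVec_le B v) (opNorm_nonneg' A))

lemma one_le_opNorm_one (hd : 2 ≤ d) : 1 ≤ opNorm (1 : Matrix (Fin d) (Fin d) ℝ) := by
  have hv : (Pi.single ⟨0, by omega⟩ 1 : Fin d → ℝ) ≠ 0 := by simp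
  have h := eNorm_mulVec_le (1 : Matrix (Fin d) (Fin d) ℝ) (Pi.single ⟨0, by omega⟩ 1)
  rw [Matrix.one_mulVec] at h
  have hpos : 0 < eNorm (Pi.single ⟨0, by omega⟩ 1 : Fin d → ℝ) :=
    lt_of_le_of_ne (eNorm_nonneg' _) (Ne.symm fun h0 => hv ((eNorm_eq_zero' _).1 h0))
  exact (le_mul_iff_one_le_left hpos).1 h

lemma norm_le_eNorm (v : Fin d → ℝ) : ‖v‖ ≤ eNorm v := by
  refine (pi_norm_le_iff_of_nonneg (eNorm_nonneg' v)).2 fun i => ?_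
  exact PiLp.norm_apply_le (WithLp.toLp 2 v) i

lemma exists_eNorm_le (d : ℕ) : ∃ c : ℝ, 1 ≤ c ∧ ∀ v : Fin d → ℝ, eNorm v ≤ c * ‖v‖ := by
  refine ⟨max 1 ‖((EuclideanSpace.equiv (Fin d) ℝ).symm : (Fin d → ℝ) →L[ℝ] EuclideanSpace ℝ (Fin d))‖,
    le_max_left _ _, fun v => ?_⟩
  have := ((EuclideanSpace.equiv (Fin d) ℝ).symm : (Fin d → ℝ) →L[ℝ] EuclideanSpace ℝ (Fin d)).le_opNorm v
  exact le_trans this (mul_le_mul_of_nonneg_right (le_max_right _ _) (norm_nonneg _))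

lemma exists_mulVec_le (h : Matrix (Fin d) (Fin d) ℝ) :
    ∃ c : ℝ, 1 ≤ c ∧ ∀ v : Fin d → ℝ, ‖h.mulVec v‖ ≤ c * ‖v‖ := by
  refine ⟨max 1 ‖(Matrix.toLin' h).toContinuousLinearMap‖, le_max_left _ _, fun v => ?_⟩
  have := (Matrix.toLin' h).toContinuousLinearMap.le_opNorm v
  exact le_trans this (mul_le_mul_of_nonneg_right (le_max_right _ _) (norm_nonneg _))

lemma entry_le_opNorm (A : Matrix (Fin d) (Fin d) ℝ) (i j : Fin d) : |A i j| ≤ opNorm A := by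
  have h := eNorm_mulVec_le A (Pi.single j 1)
  have e : eNorm (Pi.single j 1 : Fin d → ℝ) = 1 := by
    have : (WithLp.equiv 2 (Fin d → ℝ)).symm (Pi.single j 1) = EuclideanSpace.single j 1 := rfl
    rw [eNorm, this]; simp
  rw [e, mul_one] at h
  refine le_trans ?_ ((norm_le_eNorm _).trans h)
  have := norm_le_pi_norm (A.mulVec (Pi.single j 1)) i
  simpa using this

lemma exists_opNorm_adjugate (d : ℕ) : ∃ c : ℝ, 1 ≤ c ∧ ∀ A : Matrix (Fin d) (Fin d) ℝ,
    opNorm A.adjugate ≤ c * (max 1 (opNorm A)) ^ d := by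
  obtain ⟨c, hc, hcv⟩ := exists_eNorm_le d
  refine ⟨max 1 (c * (d * d.factorial)), le_max_left _ _, fun A => ?_⟩
  set x := max 1 (opNorm A) with hx
  have hx1 : 1 ≤ x := le_max_left _ _
  have hx0 : 0 ≤ x := by linarith
  have hent : ∀ i j, |A.adjugate i j| ≤ d.factorial * x ^ d := by
    intro i j
    rw [Matrix.adjugate_apply]
    have := Matrix.det_le (abv := AbsoluteValue.abs) (x := x)
      (A := A.updateRow j (Pi.single i 1)) (fun a b => by
        rw [Matrix.updateRow_apply]
        split_ifs
        · by_cases hb : b = i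
          · subst hb; simpa using hx1
          · simp [hb]; exact hx0
        · exact (entry_le_opNorm A a b).trans (le_max_right _ _))
    simpa using this
  have h1 : opNorm A.adjugate ≤ c * (d * d.factorial) * x ^ d := by
    refine opNorm_le _ _ (by positivity) fun v => ?_
    have h2 : ‖A.adjugate.mulVec v‖ ≤ (d * d.factorial * x ^ d) * ‖v‖ := by
      refine (pi_norm_le_iff_of_nonneg (by positivity)).2 fun i => ?_
      calc ‖A.adjugate.mulVec v i‖ = ‖∑ j, A.adjugate i j * v j‖ := rfl
        _ ≤ ∑ j, ‖A.adjugate i j * v j‖ := norm_sum_le _ _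
        _ ≤ ∑ j : Fin d, (d.factorial * x ^ d) * ‖v‖ := by
            refine Finset.sum_le_sum fun j _ => ?_
            rw [norm_mul]
            exact mul_le_mul (hent i j) (norm_le_pi_norm v j) (norm_nonneg _) (by positivity)
        _ = _ := by simp; ring
    calc eNorm (A.adjugate.mulVec v) ≤ c * ‖A.adjugate.mulVec v‖ := hcv _
      _ ≤ c * ((d * d.factorial * x ^ d) * eNorm v) := by
          refine mul_le_mul_of_nonneg_left (h2.trans ?_) (by linarith)
          exact mul_le_mul_of_nonneg_left (norm_le_eNorm v) (by positivity)
      _ = _ := by ring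
  exact h1.trans (mul_le_mul_of_nonneg_right (le_max_right _ _) (by positivity))

/-- The nonzero vectors. -/
def NZ (d : ℕ) : Type := {v : Fin d → ℝ // v ≠ 0}

lemma sl_mulVec_ne_zero (g : Matrix.SpecialLinearGroup (Fin d) ℝ) {v : Fin d → ℝ} (hv : v ≠ 0) :
    g.1.mulVec v ≠ 0 := by
  intro h
  apply hv
  have : (g⁻¹ * g).1.mulVec v = 0 := by
    rw [Matrix.SpecialLinearGroup.coe_mul, ← Matrix.mulVec_mulVec, h, Matrix.mulVec_zero]
  rw [inv_mul_cancel, Matrix.SpecialLinearGroup.coe_one, Matrix.one_mulVec] at this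
  exact this

instance : MulAction (Matrix.SpecialLinearGroup (Fin d) ℝ) (NZ d) where
  smul g v := ⟨g.1.mulVec v.1, sl_mulVec_ne_zero g v.2⟩
  one_smul v := Subtype.ext (Matrix.one_mulVec v.1)
  mul_smul g h v := Subtype.ext (by
    change (g * h).1.mulVec v.1 = g.1.mulVec (h.1.mulVec v.1)
    rw [Matrix.SpecialLinearGroup.coe_mul, Matrix.mulVec_mulVec])

lemma smul_val {Γ : Subgroup (Matrix.SpecialLinearGroup (Fin d) ℝ)} (g : Γ) (v : NZ d) :
    (g • v).1 = g.1.1.mulVec v.1 := rfl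

/-- the length function -/
noncomputable def len (g : Matrix.SpecialLinearGroup (Fin d) ℝ) : ℝ :=
  max (Real.log (opNorm g.1)) (Real.log (opNorm (g⁻¹).1))

lemma one_le_opNorm_mul_inv (hd : 2 ≤ d) (g : Matrix.SpecialLinearGroup (Fin d) ℝ) :
    1 ≤ opNorm g.1 * opNorm (g⁻¹).1 := by
  refine le_trans ?_ (opNorm_mul_le _ _)
  rw [← Matrix.SpecialLinearGroup.coe_mul, mul_inv_cancel]
  exact one_le_opNorm_one hd

lemma opNorm_pos (hd : 2 ≤ d) (g : Matrix.SpecialLinearGroup (Fin d) ℝ) : 0 < opNorm g.1 := by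
  refine lt_of_le_of_ne (opNorm_nonneg' _) fun h => ?_
  have := one_le_opNorm_mul_inv hd g
  rw [← h] at this
  norm_num at this

lemma log_add_log_inv (hd : 2 ≤ d) (g : Matrix.SpecialLinearGroup (Fin d) ℝ) :
    0 ≤ Real.log (opNorm g.1) + Real.log (opNorm (g⁻¹).1) := by
  rw [← Real.log_mul (opNorm_pos hd g).ne' (opNorm_pos hd g⁻¹).ne']
  exact Real.log_nonneg (one_le_opNorm_mul_inv hd g)

lemma abs_log_le_len (hd : 2 ≤ d) (g : Matrix.SpecialLinearGroup (Fin d) ℝ) :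
    |Real.log (opNorm g.1)| ≤ len g := by
  have h1 := log_add_log_inv hd g
  refine abs_le'.2 ⟨le_max_left _ _, ?_⟩
  have : Real.log (opNorm (g⁻¹).1) ≤ len g := le_max_right _ _
  linarith

lemma len_nonneg (hd : 2 ≤ d) (g : Matrix.SpecialLinearGroup (Fin d) ℝ) : 0 ≤ len g :=
  (abs_nonneg _).trans (abs_log_le_len hd g)

lemma log_opNorm_mul_le (hd : 2 ≤ d) (g h : Matrix.SpecialLinearGroup (Fin d) ℝ) :
    Real.log (opNorm (g * h).1) ≤ Real.log (opNorm g.1) + Real.log (opNorm h.1) := by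
  rw [← Real.log_mul (opNorm_pos hd g).ne' (opNorm_pos hd h).ne']
  refine Real.log_le_log (opNorm_pos hd _) ?_
  rw [Matrix.SpecialLinearGroup.coe_mul]
  exact opNorm_mul_le _ _

lemma len_mul_le (hd : 2 ≤ d) (g h : Matrix.SpecialLinearGroup (Fin d) ℝ) :
    len (g * h) ≤ len g + len h := by
  refine max_le ?_ ?_
  · exact (log_opNorm_mul_le hd g h).trans (add_le_add (le_max_left _ _) (le_max_left _ _))
  · rw [mul_inv_rev, add_comm]
    exact (log_opNorm_mul_le hd _ _).trans (add_le_add (le_max_right _ _) (le_max_right _ _))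

lemma exists_len_le (hd : 2 ≤ d) : ∃ c : ℝ, ∀ g : Matrix.SpecialLinearGroup (Fin d) ℝ,
    len g ≤ c + (d + 1) * |Real.log (opNorm g.1)| := by
  obtain ⟨c, hc, h⟩ := exists_opNorm_adjugate d
  refine ⟨Real.log c, fun g => ?_⟩
  have hlc := Real.log_nonneg hc
  have h0 := abs_nonneg (Real.log (opNorm g.1))
  refine max_le ?_ ?_
  · have := le_abs_self (Real.log (opNorm g.1))
    nlinarith [mul_nonneg (Nat.cast_nonneg (α := ℝ) d) h0]
  · have h1 : opNorm (g⁻¹).1 ≤ c * (max 1 (opNorm g.1)) ^ d := by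
      have := h g.1
      rwa [← Matrix.SpecialLinearGroup.coe_inv] at this
    have hm : 0 < max 1 (opNorm g.1) := lt_of_lt_of_le one_pos (le_max_left _ _)
    have h2 := Real.log_le_log (opNorm_pos hd g⁻¹) h1
    rw [Real.log_mul (by linarith) (pow_pos hm d).ne', Real.log_pow] at h2
    have h3 : Real.log (max 1 (opNorm g.1)) ≤ |Real.log (opNorm g.1)| := by
      rcases max_cases 1 (opNorm g.1) with ⟨e, -⟩ | ⟨e, -⟩
      · rw [e, Real.log_one]; exact h0
      · rw [e]; exact le_abs_self _
    have h4 := mul_le_mul_of_nonneg_left h3 (Nat.cast_nonneg (α := ℝ) d)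
    linarith

/-- the cocycle for the sup norm in the coordinates given by `h` -/
noncomputable def coc (h : Matrix (Fin d) (Fin d) ℝ) (g : Matrix.SpecialLinearGroup (Fin d) ℝ)
    (v : NZ d) : ℝ := Real.log ‖h.mulVec (g.1.mulVec v.1)‖ - Real.log ‖h.mulVec v.1‖

lemma coc_mul (h : Matrix (Fin d) (Fin d) ℝ) (g g' : Matrix.SpecialLinearGroup (Fin d) ℝ)
    (v : NZ d) : coc h (g * g') v = coc h g (g' • v) + coc h g' v := by
  have : (g' • v).1 = g'.1.mulVec v.1 := rfl
  rw [coc, coc, coc, this, Matrix.SpecialLinearGroup.coe_mul, ← Matrix.mulVec_mulVec]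
  ring

lemma h_mulVec_pos {h : Matrix (Fin d) (Fin d) ℝ} (hh : IsUnit h.det) {v : Fin d → ℝ}
    (hv : v ≠ 0) : 0 < ‖h.mulVec v‖ := by
  rw [norm_pos_iff]
  intro h0
  apply hv
  have : h⁻¹.mulVec (h.mulVec v) = 0 := by rw [h0, Matrix.mulVec_zero]
  rwa [Matrix.mulVec_mulVec, Matrix.nonsing_inv_mul _ hh, Matrix.one_mulVec] at this

lemma exists_coc_le (hd : 2 ≤ d) {h : Matrix (Fin d) (Fin d) ℝ} (hh : IsUnit h.det) :
    ∃ K : ℝ, 0 ≤ K ∧ ∀ (g : Matrix.SpecialLinearGroup (Fin d) ℝ) (v : NZ d),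
      coc h g v ≤ K + Real.log (opNorm g.1) := by
  obtain ⟨c1, h1, b1⟩ := exists_mulVec_le h
  obtain ⟨c2, h2, b2⟩ := exists_mulVec_le h⁻¹
  obtain ⟨c3, h3, b3⟩ := exists_eNorm_le d
  have hc : 1 ≤ c1 * c3 * c2 := one_le_mul_of_one_le_of_one_le
    (one_le_mul_of_one_le_of_one_le h1 h3) h2
  refine ⟨Real.log (c1 * c3 * c2), Real.log_nonneg hc, fun g v => ?_⟩
  have p1 := h_mulVec_pos hh v.2
  have p2 := h_mulVec_pos hh (sl_mulVec_ne_zero g v.2)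
  have p3 := opNorm_pos hd g
  have key : ‖h.mulVec (g.1.mulVec v.1)‖ ≤ (c1 * c3 * c2) * opNorm g.1 * ‖h.mulVec v.1‖ := by
    have e : ‖v.1‖ ≤ c2 * ‖h.mulVec v.1‖ := by
      have := b2 (h.mulVec v.1)
      rwa [Matrix.mulVec_mulVec, Matrix.nonsing_inv_mul _ hh, Matrix.one_mulVec] at this
    calc ‖h.mulVec (g.1.mulVec v.1)‖ ≤ c1 * ‖g.1.mulVec v.1‖ := b1 _
      _ ≤ c1 * (opNorm g.1 * (c3 * (c2 * ‖h.mulVec v.1‖))) := by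
          refine mul_le_mul_of_nonneg_left ?_ (by linarith)
          refine (norm_le_eNorm _).trans ((eNorm_mulVec_le _ _).trans ?_)
          refine mul_le_mul_of_nonneg_left ?_ p3.le
          exact (b3 _).trans (mul_le_mul_of_nonneg_left e (by linarith))
      _ = _ := by ring
  have := Real.log_le_log p2 key
  rw [Real.log_mul (mul_pos (by linarith) p3).ne' p1.ne', Real.log_mul (by linarith) p3.ne'] at this
  rw [coc]
  linarith

lemma abs_coc_le (h : Matrix (Fin d) (Fin d) ℝ) (K : ℝ)
    (hK : ∀ (g : Matrix.SpecialLinearGroup (Fin d) ℝ) (v : NZ d),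
      coc h g v ≤ K + Real.log (opNorm g.1)) (g : Matrix.SpecialLinearGroup (Fin d) ℝ) (v : NZ d) :
    |coc h g v| ≤ K + len g := by
  have e0 : coc h (g⁻¹ * g) v = 0 := by
    simp [coc]
  rw [coc_mul] at e0
  have h1 := hK g v
  have h2 := hK g⁻¹ (g • v)
  have h3 : Real.log (opNorm g.1) ≤ len g := le_max_left _ _
  have h4 : Real.log (opNorm (g⁻¹).1) ≤ len g := le_max_right _ _
  exact abs_le'.2 ⟨by linarith, by linarith⟩

end Geometry

section Dynamics

variable {d : ℕ}

/-- Zariski density moves every nonzero vector off two given coordinate hyperplanes. -/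
lemma exists_off_axes (Γ : Subgroup (Matrix.SpecialLinearGroup (Fin d) ℝ))
    (hZar : ∀ p : MvPolynomial (Fin d × Fin d) ℝ,
      (∀ g : Γ, MvPolynomial.eval
        (fun q : Fin d × Fin d =>
          ((g : Matrix.SpecialLinearGroup (Fin d) ℝ) : Matrix (Fin d) (Fin d) ℝ) q.1 q.2) p = 0)
      → ∀ g : Matrix.SpecialLinearGroup (Fin d) ℝ, MvPolynomial.eval
        (fun q : Fin d × Fin d => (g : Matrix (Fin d) (Fin d) ℝ) q.1 q.2) p = 0)
    (h : Matrix (Fin d) (Fin d) ℝ) (hh : IsUnit h.det) (i j : Fin d) (hij : i ≠ j)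
    (v : Fin d → ℝ) (hv : v ≠ 0) :
    ∃ g : Γ, h.mulVec (g.1.1.mulVec v) i * h.mulVec (g.1.1.mulVec v) j ≠ 0 := by
  by_contra! hcon
  let P : Fin d → MvPolynomial (Fin d × Fin d) ℝ := fun i =>
    ∑ a, ∑ b, MvPolynomial.C (h i a * v b) * MvPolynomial.X (a, b)
  have hP : ∀ (A : Matrix (Fin d) (Fin d) ℝ) (i : Fin d),
      MvPolynomial.eval (fun q : Fin d × Fin d => A q.1 q.2) (P i) = h.mulVec (A.mulVec v) i := by
    intro A i
    simp only [P, map_sum, map_mul, MvPolynomial.eval_C, MvPolynomial.eval_X, Matrix.mulVec,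
      dotProduct, Finset.mul_sum]
    refine Finset.sum_congr rfl fun a _ => Finset.sum_congr rfl fun b _ => ?_
    ring
  have hall := hZar (P i * P j) (fun g => by
    rw [map_mul, hP, hP]; exact hcon g)
  -- an element of `SL(d,ℝ)` contradicting this
  let w : Fin d → ℝ := fun _ => 1
  have hw : w ≠ 0 := fun e => by
    have := congrFun e i
    simp [w] at this
  obtain ⟨A, hA⟩ := SeparatingDual.exists_continuousLinearEquiv_apply_eq (R := ℝ) hv hw
  let M : Matrix (Fin d) (Fin d) ℝ := LinearMap.toMatrix' (A.toLinearEquiv : (Fin d → ℝ) →ₗ[ℝ] _)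
  have hMv : M.mulVec v = w := by
    rw [← hA, ← Matrix.toLin'_apply, Matrix.toLin'_toMatrix']; rfl
  have hMdet : M.det ≠ 0 := by
    have : IsUnit M.det := by
      rw [LinearMap.det_toMatrix']
      exact LinearEquiv.isUnit_det' A.toLinearEquiv
    exact this.ne_zero
  have hhd : h.det ≠ 0 := hh.ne_zero
  let c : ℝ := h.det / M.det
  have hc : c ≠ 0 := div_ne_zero hhd hMdet
  let B : Matrix (Fin d) (Fin d) ℝ := Matrix.diagonal (Function.update 1 i c)
  have hB : B.det = c := by
    simp only [B, Matrix.det_diagonal]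
    rw [Finset.prod_update_of_mem (Finset.mem_univ i)]
    simp
  have hdet : (h⁻¹ * B * M).det = 1 := by
    rw [Matrix.det_mul, Matrix.det_mul, hB, Matrix.det_nonsing_inv, Ring.inverse_eq_inv']
    simp only [c]
    field_simp
  have := hall ⟨h⁻¹ * B * M, hdet⟩
  rw [map_mul, hP, hP] at this
  have e : h.mulVec ((h⁻¹ * B * M).mulVec v) = B.mulVec w := by
    rw [← Matrix.mulVec_mulVec, hMv, Matrix.mulVec_mulVec, ← mul_assoc,
      Matrix.mul_nonsing_inv _ hh, one_mul]
  change h.mulVec ((h⁻¹ * B * M).mulVec v) i * h.mulVec ((h⁻¹ * B * M).mulVec v) j = 0 at this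
  rw [e] at this
  simp [B, Matrix.mulVec_diagonal, w, Function.update_of_ne hij.symm, hc] at this

/-- Uniform version over all nonzero vectors. -/
lemma exists_uniform_path (Γ : Subgroup (Matrix.SpecialLinearGroup (Fin d) ℝ))
    (h : Matrix (Fin d) (Fin d) ℝ) (i j : Fin d) (w : Γ → ℝ)
    (hall : ∀ v : Fin d → ℝ, v ≠ 0 → ∃ l : List Γ, 0 < (l.map w).prod ∧
      h.mulVec (l.prod.1.1.mulVec v) i * h.mulVec (l.prod.1.1.mulVec v) j ≠ 0) :
    ∃ (m : ℕ) (p ε : ℝ), 0 < p ∧ 0 < ε ∧ ∀ v : NZ d, ∃ l : List Γ, l.length ≤ m ∧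
      p ≤ (l.map w).prod ∧ ε * ‖h.mulVec (l.prod • v).1‖ ^ 2 ≤
        |h.mulVec (l.prod • v).1 i| * |h.mulVec (l.prod • v).1 j| := by
  have key : ∃ (m : ℕ) (p ε : ℝ), 0 < p ∧ 0 < ε ∧ ∀ v ∈ Metric.sphere (0 : Fin d → ℝ) 1,
      ∃ l : List Γ, l.length ≤ m ∧
      p ≤ (l.map w).prod ∧ ε * ‖h.mulVec (l.prod.1.1.mulVec v)‖ ^ 2 ≤
        |h.mulVec (l.prod.1.1.mulVec v) i| * |h.mulVec (l.prod.1.1.mulVec v) j| := by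
    refine (isCompact_sphere (0 : Fin d → ℝ) 1).induction_on
      (p := fun s => ∃ (m : ℕ) (p ε : ℝ), 0 < p ∧ 0 < ε ∧ ∀ v ∈ s,
      ∃ l : List Γ, l.length ≤ m ∧
      p ≤ (l.map w).prod ∧ ε * ‖h.mulVec (l.prod.1.1.mulVec v)‖ ^ 2 ≤
        |h.mulVec (l.prod.1.1.mulVec v) i| * |h.mulVec (l.prod.1.1.mulVec v) j|) ?_ ?_ ?_ ?_
    · exact ⟨0, 1, 1, one_pos, one_pos, fun v hv => hv.elim⟩
    · rintro s t hst ⟨m, p, ε, hp, hε, H⟩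
      exact ⟨m, p, ε, hp, hε, fun v hv => H v (hst hv)⟩
    · rintro s t ⟨m, p, ε, hp, hε, H⟩ ⟨m', p', ε', hp', hε', H'⟩
      refine ⟨max m m', min p p', min ε ε', lt_min hp hp', lt_min hε hε', ?_⟩
      rintro v (hv | hv)
      · obtain ⟨l, a, b, c⟩ := H v hv
        refine ⟨l, a.trans (le_max_left _ _), (min_le_left _ _).trans b, le_trans ?_ c⟩
        exact mul_le_mul_of_nonneg_right (min_le_left _ _) (by positivity)
      · obtain ⟨l, a, b, c⟩ := H' v hv
        refine ⟨l, a.trans (le_max_right _ _), (min_le_right _ _).trans b, le_trans ?_ c⟩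
        exact mul_le_mul_of_nonneg_right (min_le_right _ _) (by positivity)
    · intro v hv
      have hv0 : v ≠ 0 := by
        rintro rfl
        simp at hv
      obtain ⟨l, hl, hne⟩ := hall v hv0
      set U : (Fin d → ℝ) → (Fin d → ℝ) := fun v => h.mulVec (l.prod.1.1.mulVec v) with hU
      have hUc : Continuous U := by
        have : Continuous fun v : Fin d → ℝ => (h * l.prod.1.1).mulVec v :=
          Continuous.matrix_mulVec continuous_const continuous_id
        simpa only [hU, Matrix.mulVec_mulVec] using this
      have hpos : 0 < |U v i| * |U v j| := by
        rw [← abs_mul]; exact abs_pos.2 hne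
      set ε := |U v i| * |U v j| / (2 * (‖U v‖ ^ 2 + 1)) with hε
      have hε0 : 0 < ε := by positivity
      have hlt : ε * ‖U v‖ ^ 2 < |U v i| * |U v j| := by
        rw [hε, div_mul_eq_mul_div, div_lt_iff₀ (by positivity)]
        refine mul_lt_mul_of_pos_left ?_ hpos
        nlinarith [sq_nonneg ‖U v‖]
      have hc1 : Continuous fun v => ε * ‖U v‖ ^ 2 := by fun_prop
      have hc2 : Continuous fun v => |U v i| * |U v j| := by fun_prop
      have hev : ∀ᶠ y in 𝓝 v, ε * ‖U y‖ ^ 2 < |U y i| * |U y j| :=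
        hc1.continuousAt.eventually_lt hc2.continuousAt hlt
      refine ⟨{y | ε * ‖U y‖ ^ 2 < |U y i| * |U y j|}, mem_nhdsWithin_of_mem_nhds hev,
        l.length, (l.map w).prod, ε, hl, hε0, fun y hy => ⟨l, le_rfl, le_rfl, ?_⟩⟩
      exact le_of_lt hy
  obtain ⟨m, p, ε, hp, hε, H⟩ := key
  refine ⟨m, p, ε, hp, hε, fun v => ?_⟩
  have hn : 0 < ‖v.1‖ := norm_pos_iff.2 v.2
  obtain ⟨l, a, b, c⟩ := H (‖v.1‖⁻¹ • v.1) (by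
    rw [mem_sphere_zero_iff_norm, norm_smul, norm_inv, norm_norm, inv_mul_cancel₀ hn.ne'])
  refine ⟨l, a, b, ?_⟩
  rw [smul_val]
  simp only [Matrix.mulVec_smul, Pi.smul_apply, smul_eq_mul, norm_smul, norm_inv, norm_norm,
    abs_mul, abs_inv, abs_norm] at c
  have e1 : ε * (‖v.1‖⁻¹ * ‖h.mulVec (l.prod.1.1.mulVec v.1)‖) ^ 2 =
    (‖v.1‖⁻¹ ^ 2) * (ε * ‖h.mulVec (l.prod.1.1.mulVec v.1)‖ ^ 2) := by ring
  have e2 : ‖v.1‖⁻¹ * |h.mulVec (l.prod.1.1.mulVec v.1) i| *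
      (‖v.1‖⁻¹ * |h.mulVec (l.prod.1.1.mulVec v.1) j|) =
      (‖v.1‖⁻¹ ^ 2) * (|h.mulVec (l.prod.1.1.mulVec v.1) i| *
        |h.mulVec (l.prod.1.1.mulVec v.1) j|) := by ring
  rw [e1, e2] at c
  exact le_of_mul_le_mul_left c (by positivity)

lemma conj_pow_apply (γ : Matrix.SpecialLinearGroup (Fin d) ℝ) (h : Matrix (Fin d) (Fin d) ℝ)
    (a : Fin d → ℝ) (hh : IsUnit h.det) (hγ : γ.1 = h⁻¹ * Matrix.diagonal a * h)
    (k : ℕ) (v : Fin d → ℝ) (i : Fin d) :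
    h.mulVec ((γ ^ k).1.mulVec v) i = a i ^ k * h.mulVec v i := by
  induction k generalizing v with
  | zero => simp
  | succ k ih =>
    rw [pow_succ, Matrix.SpecialLinearGroup.coe_mul, ← Matrix.mulVec_mulVec, ih]
    have : h.mulVec (γ.1.mulVec v) = (Matrix.diagonal a).mulVec (h.mulVec v) := by
      rw [hγ, Matrix.mulVec_mulVec, Matrix.mulVec_mulVec, ← mul_assoc, ← mul_assoc,
        Matrix.mul_nonsing_inv _ hh, one_mul]
    rw [this, Matrix.mulVec_diagonal]
    ring

lemma diag_ne_zero (γ : Matrix.SpecialLinearGroup (Fin d) ℝ) (h : Matrix (Fin d) (Fin d) ℝ)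
    (a : Fin d → ℝ) (hh : IsUnit h.det) (hγ : γ.1 = h⁻¹ * Matrix.diagonal a * h) (i : Fin d) :
    a i ≠ 0 := by
  intro h0
  have := conj_pow_apply γ h a hh hγ 1 ((γ⁻¹).1.mulVec (h⁻¹.mulVec (Pi.single i 1))) i
  rw [pow_one, Matrix.mulVec_mulVec _ γ.1, ← Matrix.SpecialLinearGroup.coe_mul, mul_inv_cancel,
    Matrix.SpecialLinearGroup.coe_one, Matrix.one_mulVec, Matrix.mulVec_mulVec,
    Matrix.mul_nonsing_inv _ hh, h0] at this
  simp at this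

/-- basic estimate: the two powers `γ^k`, `γ^{-k}` taken together -/
lemma coc_pair (γ : Matrix.SpecialLinearGroup (Fin d) ℝ) (h : Matrix (Fin d) (Fin d) ℝ)
    (a : Fin d → ℝ) (hh : IsUnit h.det) (hγ : γ.1 = h⁻¹ * Matrix.diagonal a * h)
    (k : ℕ) (v : NZ d) (i j : Fin d) (ε : ℝ) (hε : 0 < ε)
    (hv : ε * ‖h.mulVec v.1‖ ^ 2 ≤ |h.mulVec v.1 i| * |h.mulVec v.1 j|) :
    k * Real.log (|a i| / |a j|) + Real.log ε ≤
      coc h (γ ^ k) v + coc h ((γ ^ k)⁻¹) v := by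
  have ai := abs_pos.2 (diag_ne_zero γ h a hh hγ i)
  have aj := abs_pos.2 (diag_ne_zero γ h a hh hγ j)
  have hu := h_mulVec_pos hh v.2
  have hp := h_mulVec_pos hh (sl_mulVec_ne_zero (γ ^ k) v.2)
  have hm := h_mulVec_pos hh (sl_mulVec_ne_zero (γ ^ k)⁻¹ v.2)
  have e1 : |h.mulVec ((γ ^ k).1.mulVec v.1) i| = |a i| ^ k * |h.mulVec v.1 i| := by
    rw [conj_pow_apply γ h a hh hγ, abs_mul, abs_pow]
  have e2 : |h.mulVec v.1 j| = |a j| ^ k * |h.mulVec (((γ ^ k)⁻¹).1.mulVec v.1) j| := by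
    rw [← abs_pow, ← abs_mul, ← conj_pow_apply γ h a hh hγ, Matrix.mulVec_mulVec _ (γ ^ k).1,
      ← Matrix.SpecialLinearGroup.coe_mul, mul_inv_cancel, Matrix.SpecialLinearGroup.coe_one,
      Matrix.one_mulVec]
  have n1 := norm_le_pi_norm (h.mulVec ((γ ^ k).1.mulVec v.1)) i
  have n2 := norm_le_pi_norm (h.mulVec (((γ ^ k)⁻¹).1.mulVec v.1)) j
  rw [Real.norm_eq_abs] at n1 n2
  set N1 := ‖h.mulVec ((γ ^ k).1.mulVec v.1)‖
  set N2 := ‖h.mulVec (((γ ^ k)⁻¹).1.mulVec v.1)‖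
  have key : (|a i| / |a j|) ^ k * ε * ‖h.mulVec v.1‖ ^ 2 ≤ N1 * N2 := by
    calc (|a i| / |a j|) ^ k * ε * ‖h.mulVec v.1‖ ^ 2
        ≤ (|a i| / |a j|) ^ k * (|h.mulVec v.1 i| * |h.mulVec v.1 j|) := by
          rw [mul_assoc]
          exact mul_le_mul_of_nonneg_left hv (by positivity)
      _ = (|a i| ^ k * |h.mulVec v.1 i|) * |h.mulVec (((γ ^ k)⁻¹).1.mulVec v.1) j| := by
          rw [e2, div_pow]; field_simp
      _ ≤ N1 * N2 := by
          rw [← e1]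
          exact mul_le_mul n1 n2 (abs_nonneg _) hp.le
  have L := Real.log_le_log (by positivity) key
  rw [Real.log_mul (by positivity) (by positivity), Real.log_mul (by positivity) hε.ne',
    Real.log_mul hp.ne' hm.ne', Real.log_pow, Real.log_pow] at L
  push_cast at L
  rw [coc, coc]
  linarith

lemma coc_pair_nonneg (γ : Matrix.SpecialLinearGroup (Fin d) ℝ) (h : Matrix (Fin d) (Fin d) ℝ)
    (a : Fin d → ℝ) (hh : IsUnit h.det) (hγ : γ.1 = h⁻¹ * Matrix.diagonal a * h)
    (hd : 2 ≤ d) (k : ℕ) (v : NZ d) :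
    0 ≤ coc h (γ ^ k) v + coc h ((γ ^ k)⁻¹) v := by
  have : Nonempty (Fin d) := ⟨⟨0, by omega⟩⟩
  obtain ⟨i, hi⟩ := Finite.exists_max fun i => |h.mulVec v.1 i|
  have hn : ‖h.mulVec v.1‖ ≤ |h.mulVec v.1 i| :=
    (pi_norm_le_iff_of_nonneg (abs_nonneg _)).2 hi
  have ai := abs_pos.2 (diag_ne_zero γ h a hh hγ i)
  have := coc_pair γ h a hh hγ k v i i 1 one_pos (by
    rw [one_mul, sq]
    exact mul_le_mul hn hn (norm_nonneg _) (abs_nonneg _))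
  simpa [div_self ai.ne'] using this

lemma hasSum_mix {G : Type*} [DecidableEq G] (μ F : G → ℝ) (S : ℝ) (y z : G)
    (hS : HasSum (fun x => μ x * F x) S) :
    HasSum (fun x => ((1 / 2) * μ x + (1 / 4) * ((if x = y then (1 : ℝ) else 0) +
      (if x = z then (1 : ℝ) else 0))) * F x) ((1 / 2) * S + (1 / 4) * (F y + F z)) := by
  have h := (hS.mul_left (1 / 2)).add
    (((hasSum_ite_eq y (F y)).add (hasSum_ite_eq z (F z))).mul_left (1 / 4))
  refine h.congr_fun fun x => ?_
  by_cases h1 : x = y <;> by_cases h2 : x = z <;> simp [h1, h2] <;> grind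

end Dynamics
/-- Let `Γ` be a countable Zariski dense subgroup of `SL(d,ℝ)`, `μ` a probability measure on
`Γ` whose support generates `Γ` as a semigroup, with finite entropy and finite first moment,
and let `γ ∈ Γ` be an `ℝ`-regular element. Then the top Lyapunov exponents
`λ₁(μ^k) = liminf_n (1/n) ∑_g (μ^k)^{∗n}(g) log ‖g‖` of the measures
`μ^k = (1/2)μ + (1/4)(δ_{γ^k} + δ_{γ^{-k}})` tend to `+∞` as `k → ∞`. -/
theorem top_lyapunov_exponent_tendsto_atTop {d : ℕ} (hd : 2 ≤ d)
    (Γ : Subgroup (Matrix.SpecialLinearGroup (Fin d) ℝ)) [Countable Γ] [DecidableEq Γ]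
    (hZar : ∀ p : MvPolynomial (Fin d × Fin d) ℝ,
      (∀ g : Γ, MvPolynomial.eval
        (fun q : Fin d × Fin d =>
          ((g : Matrix.SpecialLinearGroup (Fin d) ℝ) : Matrix (Fin d) (Fin d) ℝ) q.1 q.2) p = 0)
      → ∀ g : Matrix.SpecialLinearGroup (Fin d) ℝ, MvPolynomial.eval
        (fun q : Fin d × Fin d => (g : Matrix (Fin d) (Fin d) ℝ) q.1 q.2) p = 0)
    (μ : Γ → ℝ) (hnonneg : ∀ g, 0 ≤ μ g) (hprob : HasSum μ 1)
    (hgen : ∀ g : Γ, ∃ l : List Γ, (∀ x ∈ l, 0 < μ x) ∧ l.prod = g)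
    (hent : Summable fun g : Γ => Real.negMulLog (μ g))
    (hmom : Summable fun g : Γ => μ g *
      Real.log (opNorm ((g : Matrix.SpecialLinearGroup (Fin d) ℝ) : Matrix (Fin d) (Fin d) ℝ)))
    (γ : Γ)
    (hreg : ∃ (h : Matrix (Fin d) (Fin d) ℝ) (a : Fin d → ℝ), IsUnit h.det ∧
      (∀ i j : Fin d, i ≠ j → |a i| ≠ |a j|) ∧
      ((γ : Matrix.SpecialLinearGroup (Fin d) ℝ) : Matrix (Fin d) (Fin d) ℝ)
        = h⁻¹ * Matrix.diagonal a * h) :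
    Tendsto (fun k : ℕ =>
      liminf (fun n : ℕ => (1 / (n : ℝ)) * ∑' g : Γ,
        convPow (fun x : Γ => (1 / 2) * μ x +
          (1 / 4) * ((if x = γ ^ (k : ℤ) then (1 : ℝ) else 0) +
            (if x = γ ^ (-(k : ℤ)) then (1 : ℝ) else 0))) n g *
        Real.log (opNorm
          ((g : Matrix.SpecialLinearGroup (Fin d) ℝ) : Matrix (Fin d) (Fin d) ℝ))) atTop)
      atTop atTop := by
  obtain ⟨h, a, hh, ha, hγ⟩ := hreg
  -- two indices with distinct moduli
  obtain ⟨i, j, hij, hlt⟩ : ∃ i j : Fin d, i ≠ j ∧ |a j| < |a i| := by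
    have hne : (⟨0, by omega⟩ : Fin d) ≠ ⟨1, by omega⟩ := by simp
    rcases lt_or_gt_of_ne (ha _ _ hne) with h1 | h1
    · exact ⟨_, _, hne.symm, h1⟩
    · exact ⟨_, _, hne, h1⟩
  have aj : 0 < |a j| := abs_pos.2 (diag_ne_zero γ.1 h a hh hγ j)
  have hρ : 0 < Real.log (|a i| / |a j|) := Real.log_pos ((one_lt_div aj).2 hlt)
  set ρ := Real.log (|a i| / |a j|) with hρdef
  -- uniform paths
  let w : Γ → ℝ := fun x => (1 / 2) * μ x
  obtain ⟨m, p, ε, hp, hε, hpaths⟩ := exists_uniform_path Γ h i j w (by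
    intro v hv
    obtain ⟨g, hg⟩ := exists_off_axes Γ hZar h hh i j hij v hv
    obtain ⟨l, hl, hlg⟩ := hgen g
    refine ⟨l, List.prod_pos ?_, by rw [hlg]; exact hg⟩
    intro z hz
    obtain ⟨u, hu, rfl⟩ := List.mem_map.1 hz
    have := hl u hu
    positivity)
  -- length and cocycle
  obtain ⟨K, hK0, hK⟩ := exists_coc_le hd hh
  let ℓ : Γ → ℝ := fun g => len g.1
  have hℓ0 : ∀ g, 0 ≤ ℓ g := fun g => len_nonneg hd g.1
  have hℓ : ∀ g g', ℓ (g * g') ≤ ℓ g + ℓ g' := fun g g' => len_mul_le hd g.1 g'.1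
  have hμℓ : Summable fun g => μ g * ℓ g := by
    obtain ⟨c, hc⟩ := exists_len_le hd
    have s1 : Summable fun g : Γ => μ g * c + (d + 1) * |μ g * Real.log (opNorm g.1.1)| :=
      (hprob.summable.mul_right c).add (hmom.abs.mul_left _)
    refine Summable.of_nonneg_of_le (fun g => mul_nonneg (hnonneg g) (hℓ0 g)) (fun g => ?_) s1
    rw [abs_mul, abs_of_nonneg (hnonneg g)]
    have := mul_le_mul_of_nonneg_left (hc g.1) (hnonneg g)
    change μ g * len g.1 ≤ _
    linarith
  let σ : Γ → NZ d → ℝ := fun g v => coc h g.1 v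
  have hσ : ∀ g g' v, σ (g * g') v = σ g (g' • v) + σ g' v := fun g g' v => coc_mul h g.1 g'.1 v
  have hσK : ∀ g v, |σ g v| ≤ K + ℓ g := fun g v => abs_coc_le h K hK g.1 v
  set C : ℝ := (1 / 2) * (K + ∑' g, μ g * ℓ g) with hCdef
  have hC : 0 ≤ C := by
    have : 0 ≤ ∑' g, μ g * ℓ g := tsum_nonneg fun g => mul_nonneg (hnonneg g) (hℓ0 g)
    positivity
  have v0 : NZ d := ⟨fun _ => 1, fun e => by
    have := congrFun e i
    simp at this⟩
  -- the main lower bound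
  have main : ∀ k : ℕ, 0 ≤ (1 / 4) * (k * ρ + Real.log ε) →
      (1 / (m + 1 : ℝ)) * (p * ((1 / 4) * (k * ρ + Real.log ε)) - C * (m + 1)) - 1 ≤
      liminf (fun n : ℕ => (1 / (n : ℝ)) * ∑' g : Γ,
        convPow (fun x : Γ => (1 / 2) * μ x +
          (1 / 4) * ((if x = γ ^ (k : ℤ) then (1 : ℝ) else 0) +
            (if x = γ ^ (-(k : ℤ)) then (1 : ℝ) else 0))) n g *
        Real.log (opNorm
          ((g : Matrix.SpecialLinearGroup (Fin d) ℝ) : Matrix (Fin d) (Fin d) ℝ))) atTop := by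
    intro k hL
    set L := (1 / 4) * (k * ρ + Real.log ε) with hLdef
    set ν : Γ → ℝ := fun x : Γ => (1 / 2) * μ x +
          (1 / 4) * ((if x = γ ^ (k : ℤ) then (1 : ℝ) else 0) +
            (if x = γ ^ (-(k : ℤ)) then (1 : ℝ) else 0)) with hν
    have hw : ∀ x, w x ≤ ν x := fun x => by
      have : (0 : ℝ) ≤ (1 / 4) * ((if x = γ ^ (k : ℤ) then (1 : ℝ) else 0) +
            (if x = γ ^ (-(k : ℤ)) then (1 : ℝ) else 0)) := by positivity
      simp only [w, hν]
      linarith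
    have hw0 : ∀ x, 0 ≤ w x := fun x => by
      have := hnonneg x
      positivity
    have hν0 : ∀ x, 0 ≤ ν x := fun x => (hw0 x).trans (hw x)
    have hν1 : HasSum ν 1 := by
      have := hasSum_mix μ (fun _ => 1) 1 (γ ^ (k : ℤ)) (γ ^ (-(k : ℤ))) (by simpa using hprob)
      simp only [mul_one] at this
      convert this using 1
      norm_num
    have hνℓ : Summable fun g => ν g * ℓ g :=
      (hasSum_mix μ ℓ _ (γ ^ (k : ℤ)) (γ ^ (-(k : ℤ))) hμℓ.hasSum).summable
    have hDeq : ∀ v, ∑' g, ν g * σ g v =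
        (1 / 2) * ∑' g, μ g * σ g v + (1 / 4) * (coc h (γ.1 ^ k) v + coc h ((γ.1 ^ k)⁻¹) v) := by
      intro v
      have s := (summable_dom μ ℓ (fun g => σ g v) K hnonneg hprob hμℓ fun g => hσK g v).1
      have e := (hasSum_mix μ (fun g => σ g v) _ (γ ^ (k : ℤ)) (γ ^ (-(k : ℤ))) s.hasSum).tsum_eq
      simp only [hν]
      rw [e]
      simp [σ]
    have hμD : ∀ v, -C ≤ (1 / 2) * ∑' g, μ g * σ g v := by
      intro v
      have := (summable_dom μ ℓ (fun g => σ g v) K hnonneg hprob hμℓ fun g => hσK g v).2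
      have := (abs_le.1 this).1
      rw [hCdef]
      linarith
    have hD : ∀ v, -C ≤ ∑' g, ν g * σ g v := by
      intro v
      rw [hDeq]
      linarith [hμD v, coc_pair_nonneg γ.1 h a hh hγ hd k v]
    let good : NZ d → Prop := fun v =>
      ε * ‖h.mulVec v.1‖ ^ 2 ≤ |h.mulVec v.1 i| * |h.mulVec v.1 j|
    have hgood : ∀ v, good v → -C + L ≤ ∑' g, ν g * σ g v := by
      intro v hv
      rw [hDeq]
      linarith [hμD v, coc_pair γ.1 h a hh hγ k v i j ε hε hv]
    have lin := fun n => meanCoc_linear ν ℓ hν0 hν1 hℓ0 hℓ hνℓ σ hσ K hσK C L hD hL good hgood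
      w hw0 hw m p hpaths hC n v0
    set c := p * L - C * (m + 1) with hc
    set B := |c| + C * (m + 1) with hB
    have fin : ∀ n : ℕ, Summable (fun g : Γ => convPow ν n g * Real.log (opNorm g.1.1)) ∧
        ∑' g : Γ, convPow ν n g * Real.log (opNorm g.1.1) ≤ ℓ 1 + n * ∑' g, ν g * ℓ g ∧
        (n / (m + 1 : ℝ)) * c - B - K ≤
          ∑' g : Γ, convPow ν n g * Real.log (opNorm g.1.1) := by
      intro n
      obtain ⟨p0, p1, p2, p3⟩ := convPow_facts ν ℓ hν0 hν1 hℓ0 hℓ hνℓ n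
      obtain ⟨q1, q2⟩ := summable_dom (convPow ν n) ℓ (fun g : Γ => Real.log (opNorm g.1.1)) 0
        p0 p1 p2 (fun g => by rw [zero_add]; exact abs_log_le_len hd g.1)
      refine ⟨q1, ?_, ?_⟩
      · have := (abs_le.1 q2).2
        linarith
      · have s1 := (summable_dom (convPow ν n) ℓ (fun g => σ g v0) K p0 p1 p2
          fun g => hσK g v0).1
        have s2 := p1.summable.mul_right K
        have : meanCoc ν σ n v0 ≤ K + ∑' g : Γ, convPow ν n g * Real.log (opNorm g.1.1) := by
          calc meanCoc ν σ n v0 ≤ ∑' g : Γ, (convPow ν n g * K +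
                convPow ν n g * Real.log (opNorm g.1.1)) := by
                refine s1.tsum_le_tsum (fun g => ?_) (s2.add q1)
                rw [← mul_add]
                exact mul_le_mul_of_nonneg_left (hK g.1 v0) (p0 g)
            _ = _ := by rw [s2.tsum_add q1, tsum_mul_right, p1.tsum_eq, one_mul]
        linarith [lin n]
    refine le_liminf_of_le ?_ ?_
    · refine IsBoundedUnder.isCoboundedUnder_ge ?_
      refine isBoundedUnder_of_eventually_le (a := ℓ 1 + ∑' g, ν g * ℓ g) ?_
      filter_upwards [eventually_ge_atTop 1] with n hn
      have hn1 : (1 : ℝ) ≤ n := by exact_mod_cast hn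
      rw [one_div, inv_mul_le_iff₀ (by linarith)]
      refine (fin n).2.1.trans ?_
      have := mul_le_mul_of_nonneg_right hn1 (hℓ0 1)
      linarith
    · obtain ⟨n0, hn0⟩ := exists_nat_ge (B + K)
      filter_upwards [eventually_ge_atTop (max 1 n0)] with n hn
      have hn1 : (1 : ℝ) ≤ n := by exact_mod_cast (le_max_left _ _).trans hn
      have hn2 : (n0 : ℝ) ≤ n := by exact_mod_cast (le_max_right _ _).trans hn
      have hpos : (0 : ℝ) < n := by linarith
      rw [one_div (n : ℝ), le_inv_mul_iff₀ hpos]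
      refine le_trans ?_ (fin n).2.2
      have : (n : ℝ) * (1 / (m + 1 : ℝ) * c - 1) = n / (m + 1 : ℝ) * c - n := by ring
      rw [this]
      linarith
  -- conclusion
  have hkρ : Tendsto (fun k : ℕ => (1 / 4) * ((k : ℝ) * ρ + Real.log ε)) atTop atTop :=
    (tendsto_atTop_add_const_right _ _
      (tendsto_natCast_atTop_atTop.atTop_mul_const hρ)).const_mul_atTop (by norm_num)
  have hlow : Tendsto (fun k : ℕ => (1 / (m + 1 : ℝ)) *
      (p * ((1 / 4) * (k * ρ + Real.log ε)) - C * (m + 1)) - 1) atTop atTop := by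
    simp only [sub_eq_add_neg]
    exact tendsto_atTop_add_const_right _ _ ((tendsto_atTop_add_const_right _ _
      (hkρ.const_mul_atTop hp)).const_mul_atTop (by positivity))
  refine tendsto_atTop_mono' _ ?_ hlow
  filter_upwards [hkρ.eventually_ge_atTop 0] with k hk
  exact main k hk
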